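/- arXiv:1009.0176 — 2 statements merged into one kernel-verified Lean document; each statement's English description precedes it below -/
import Mathlib

section
/- For every integer n ≥ 1, the number of large (3,2)-Motzkin paths of length n equals twice the number of (3,2)-Motzkin paths of length n − 1; that is, L_n = 2·m_{n−1}, where L_n denotes the number of large (3,2)-Motzkin paths of length n and m_k denotes the number of (3,2)-Motzkin paths of length k. -/
/-- Steps of a (3,2)-Motzkin path: one up step, two colored down steps,
three colored level steps. -/
inductive MStep : Type
  | U | D1 | D2 | L1 | L2 | L3
  deriving DecidableEq

/-- Height contribution of a single step. -/
def MStep.height : MStep → ℤ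
  | .U  => 1
  | .D1 => -1
  | .D2 => -1
  | .L1 => 0
  | .L2 => 0
  | .L3 => 0

/-- Total height of a list of steps. -/
def mHeight (p : List MStep) : ℤ := (p.map MStep.height).sum

/-- A (3,2)-Motzkin path: all prefixes have nonnegative height and the
total height is 0. -/
def IsMotzkin32 (p : List MStep) : Prop :=
  (∀ q : List MStep, q <+: p → 0 ≤ mHeight q) ∧ mHeight p = 0

/-- A large (3,2)-Motzkin path: a (3,2)-Motzkin path with no `L3` level step
on the x-axis, i.e. the prefix preceding any `L3` step has positive height. -/
def IsLargeMotzkin32 (p : List MStep) : Prop :=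
  IsMotzkin32 p ∧ ∀ a b : List MStep, p = a ++ MStep.L3 :: b → 0 < mHeight a

/-- `m32 n` is the number of (3,2)-Motzkin paths of length `n`. -/
noncomputable def m32 (n : ℕ) : ℕ :=
  {p : List MStep | p.length = n ∧ IsMotzkin32 p}.ncard

/-- `L32 n` is the number of large (3,2)-Motzkin paths of length `n`. -/
noncomputable def L32 (n : ℕ) : ℕ :=
  {p : List MStep | p.length = n ∧ IsLargeMotzkin32 p}.ncard

/-- An elevated large (3,2)-Motzkin path: a large (3,2)-Motzkin path that
touches the x-axis only at its endpoints. -/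
def IsElevatedLargeMotzkin32 (p : List MStep) : Prop :=
  IsLargeMotzkin32 p ∧
    ∀ q : List MStep, q <+: p → q ≠ [] → q ≠ p → 0 < mHeight q

/-- A linked partition of `{1,…,n}`: blocks are nonempty subsets of
`{1,…,n}` covering it, and any two distinct blocks are nearly disjoint. -/
def IsLinkedPartition (n : ℕ) (π : Finset (Finset ℕ)) : Prop :=
  (∀ B ∈ π, B.Nonempty ∧ B ⊆ Finset.Icc 1 n) ∧
  (∀ i ∈ Finset.Icc 1 n, ∃ B ∈ π, i ∈ B) ∧
  (∀ B ∈ π, ∀ B' ∈ π, B ≠ B' → ∀ k, k ∈ B → k ∈ B' →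
    ((∀ j ∈ B, k ≤ j) ∧ 1 < B.card ∧ ¬ (∀ j ∈ B', k ≤ j)) ∨
    ((∀ j ∈ B', k ≤ j) ∧ 1 < B'.card ∧ ¬ (∀ j ∈ B, k ≤ j)))

/-- Noncrossing condition for a collection of blocks. -/
def IsNoncrossing (π : Finset (Finset ℕ)) : Prop :=
  ¬ ∃ B ∈ π, ∃ B' ∈ π, B ≠ B' ∧
      ∃ i₁ ∈ B, ∃ j₁ ∈ B, ∃ i₂ ∈ B', ∃ j₂ ∈ B',
        i₁ < i₂ ∧ i₂ < j₁ ∧ j₁ < j₂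

/-- `ncl n` is the number of noncrossing linked partitions of `{1,…,n}`. -/
noncomputable def ncl (n : ℕ) : ℕ :=
  {π : Finset (Finset ℕ) | IsLinkedPartition n π ∧ IsNoncrossing π}.ncard

/-- Steps of a Schröder path: up, level (width 2), down. -/
inductive SStep : Type
  | U | L | D
  deriving DecidableEq

/-- Height contribution of a Schröder step. -/
def SStep.height : SStep → ℤ
  | .U => 1
  | .L => 0
  | .D => -1

/-- Width contribution of a Schröder step. -/
def SStep.width : SStep → ℕ
  | .U => 1
  | .L => 2
  | .D => 1

/-- Total height of a list of Schröder steps. -/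
def sHeight (p : List SStep) : ℤ := (p.map SStep.height).sum

/-- Total width of a list of Schröder steps. -/
def sWidth (p : List SStep) : ℕ := (p.map SStep.width).sum

/-- A large Schröder path of length `2n`. -/
def IsLargeSchroeder (n : ℕ) (p : List SStep) : Prop :=
  sWidth p = 2 * n ∧ (∀ q : List SStep, q <+: p → 0 ≤ sHeight q) ∧
    sHeight p = 0

/-- A little Schröder path of length `2n`: a large Schröder path with no
level step on the x-axis. -/
def IsLittleSchroeder (n : ℕ) (p : List SStep) : Prop :=
  IsLargeSchroeder n p ∧ ∀ a b : List SStep, p = a ++ SStep.L :: b → 0 < sHeight a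

/-- `SchroederLarge n` is the `n`-th large Schröder number. -/
noncomputable def SchroederLarge (n : ℕ) : ℕ :=
  {p : List SStep | IsLargeSchroeder n p}.ncard

/-- `SchroederLittle n` is the `n`-th little Schröder number. -/
noncomputable def SchroederLittle (n : ℕ) : ℕ :=
  {p : List SStep | IsLittleSchroeder n p}.ncard

def mstepEquiv : MStep ≃ Fin 6 where
  toFun s := match s with
    | .U => 0 | .D1 => 1 | .D2 => 2 | .L1 => 3 | .L2 => 4 | .L3 => 5
  invFun i := match i with
    | 0 => .U | 1 => .D1 | 2 => .D2 | 3 => .L1 | 4 => .L2 | 5 => .L3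
  left_inv s := by cases s <;> rfl
  right_inv i := by fin_cases i <;> rfl

instance : Fintype MStep := Fintype.ofEquiv _ mstepEquiv.symm

/-- Number of lists of length `n` satisfying `Q`. -/
noncomputable def cnt (n : ℕ) (Q : List MStep → Prop) : ℕ :=
  {p : List MStep | p.length = n ∧ Q p}.ncard

lemma cnt_succ (n : ℕ) (Q : List MStep → Prop) :
    cnt (n + 1) Q = cnt n (fun p => Q (.U :: p)) + cnt n (fun p => Q (.D1 :: p))
      + cnt n (fun p => Q (.D2 :: p)) + cnt n (fun p => Q (.L1 :: p))
      + cnt n (fun p => Q (.L2 :: p)) + cnt n (fun p => Q (.L3 :: p)) := by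
  have e : {p : List MStep | p.length = n + 1 ∧ Q p} ≃
      Σ s : MStep, {p : List MStep | p.length = n ∧ Q (s :: p)} :=
    { toFun := fun p => match p with
        | ⟨[], h⟩ => absurd h.1 (by simp)
        | ⟨s :: p, h⟩ => ⟨s, p, by simpa using h.1, h.2⟩
      invFun := fun x => ⟨x.1 :: x.2.1, by simpa using x.2.2.1, x.2.2.2⟩
      left_inv := by
        rintro ⟨_ | ⟨s, p⟩, h⟩
        · exact absurd h.1 (by simp)
        · rfl
      right_inv := by rintro ⟨s, p, h⟩; rfl }
  have hf : ∀ s : MStep, Finite {p : List MStep | p.length = n ∧ Q (s :: p)} := fun s =>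
    ((List.finite_length_eq MStep n).subset (fun p hp => hp.1)).to_subtype
  have h1 := Nat.card_congr e
  rw [Nat.card_sigma] at h1
  have h2 : ∀ f : MStep → ℕ, ∑ s, f s =
      f .U + f .D1 + f .D2 + f .L1 + f .L2 + f .L3 := fun f => by
    rw [← mstepEquiv.symm.sum_comp f, Fin.sum_univ_six]; rfl
  rw [h2] at h1
  exact h1

lemma cnt_zero (Q : List MStep → Prop) [Decidable (Q [])] :
    cnt 0 Q = if Q [] then 1 else 0 := by
  unfold cnt
  split_ifs with h
  · rw [Set.ncard_eq_one]
    refine ⟨[], ?_⟩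
    ext p
    simp only [List.length_eq_zero_iff, Set.mem_ofPred_eq, Set.mem_singleton_iff]
    exact ⟨fun x => x.1, fun x => ⟨x, x ▸ h⟩⟩
  · have : {p : List MStep | p.length = 0 ∧ Q p} = ∅ := by
      ext p
      simp only [List.length_eq_zero_iff, Set.mem_ofPred_eq, Set.mem_empty_iff_false, iff_false]
      rintro ⟨rfl, hx⟩
      exact h hx
    rw [this, Set.ncard_empty]

lemma cnt_false (n : ℕ) (Q : List MStep → Prop) (h : ∀ p, ¬ Q p) : cnt n Q = 0 := by
  simp [cnt, h]

lemma mHeight_nil : mHeight [] = 0 := rfl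

lemma mHeight_cons (s : MStep) (p : List MStep) :
    mHeight (s :: p) = s.height + mHeight p := by simp [mHeight]

/-- Motzkin path started at height `h`. -/
def GM (h : ℤ) (p : List MStep) : Prop :=
  (∀ q : List MStep, q <+: p → 0 ≤ h + mHeight q) ∧ h + mHeight p = 0

/-- Large Motzkin path started at height `h`. -/
def GLarge (h : ℤ) (p : List MStep) : Prop :=
  GM h p ∧ ∀ a b : List MStep, p = a ++ MStep.L3 :: b → 0 < h + mHeight a

lemma GM_nil (h : ℤ) : GM h [] ↔ h = 0 := by
  simp only [GM, List.prefix_nil, forall_eq, mHeight_nil]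
  omega

lemma GLarge_nil (h : ℤ) : GLarge h [] ↔ h = 0 := by
  simp [GLarge, GM_nil]

lemma GM_nonneg {h : ℤ} {p : List MStep} (H : GM h p) : 0 ≤ h := by
  have := H.1 [] List.nil_prefix
  simpa [mHeight_nil] using this

lemma GM_cons (h : ℤ) (s : MStep) (p : List MStep) :
    GM h (s :: p) ↔ 0 ≤ h ∧ GM (h + s.height) p := by
  constructor
  · intro H
    refine ⟨GM_nonneg H, fun q hq => ?_, ?_⟩
    · have := H.1 (s :: q) (by simpa using hq)
      rw [mHeight_cons] at this; omega
    · have := H.2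
      rw [mHeight_cons] at this; omega
  · rintro ⟨h0, H1, H2⟩
    refine ⟨fun q hq => ?_, ?_⟩
    · rcases q with _ | ⟨t, q⟩
      · simpa [mHeight_nil] using h0
      · rw [List.cons_prefix_cons] at hq
        obtain ⟨rfl, hq⟩ := hq
        have := H1 q hq
        rw [mHeight_cons]; omega
    · rw [mHeight_cons]; omega

lemma GLarge_cons (h : ℤ) (s : MStep) (p : List MStep) :
    GLarge h (s :: p) ↔ 0 ≤ h ∧ (s = .L3 → 0 < h) ∧ GLarge (h + s.height) p := by
  unfold GLarge
  rw [GM_cons]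
  constructor
  · rintro ⟨⟨h0, H⟩, H2⟩
    refine ⟨h0, ?_, H, ?_⟩
    · rintro rfl
      simpa [mHeight_nil] using H2 [] p rfl
    · rintro a b rfl
      have := H2 (s :: a) b rfl
      rw [mHeight_cons] at this; omega
  · rintro ⟨h0, h1, H, H2⟩
    refine ⟨⟨h0, H⟩, ?_⟩
    rintro (_ | ⟨t, a⟩) b hab
    · simp only [List.nil_append, List.cons.injEq] at hab
      simpa [mHeight_nil] using h1 hab.1
    · simp only [List.cons_append, List.cons.injEq] at hab
      have := H2 a b hab.2
      rw [mHeight_cons, ← hab.1]; omega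

lemma M_neg (n : ℕ) (h : ℤ) (hh : h < 0) : cnt n (GM h) = 0 :=
  cnt_false _ _ fun _ H => absurd (GM_nonneg H) (by omega)

lemma L_neg (n : ℕ) (h : ℤ) (hh : h < 0) : cnt n (GLarge h) = 0 :=
  cnt_false _ _ fun _ H => absurd (GM_nonneg H.1) (by omega)

lemma M_succ (n : ℕ) (h : ℤ) (hh : 0 ≤ h) : cnt (n + 1) (GM h) =
    cnt n (GM (h + 1)) + 3 * cnt n (GM h) + 2 * cnt n (GM (h - 1)) := by
  rw [cnt_succ]
  simp only [GM_cons, hh, true_and, MStep.height, add_zero, ← sub_eq_add_neg]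
  change cnt n (GM (h + 1)) + cnt n (GM (h - 1)) + cnt n (GM (h - 1)) + cnt n (GM h)
    + cnt n (GM h) + cnt n (GM h) = _
  ring

lemma L_succ (n : ℕ) (h : ℤ) (hh : 0 < h) : cnt (n + 1) (GLarge h) =
    cnt n (GLarge (h + 1)) + 3 * cnt n (GLarge h) + 2 * cnt n (GLarge (h - 1)) := by
  rw [cnt_succ]
  simp only [GLarge_cons, hh, hh.le, implies_true, true_and, MStep.height, add_zero,
    ← sub_eq_add_neg]
  change cnt n (GLarge (h + 1)) + cnt n (GLarge (h - 1)) + cnt n (GLarge (h - 1)) + cnt n (GLarge h)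
    + cnt n (GLarge h) + cnt n (GLarge h) = _
  ring

lemma L_succ_zero (n : ℕ) : cnt (n + 1) (GLarge 0) =
    cnt n (GLarge 1) + 2 * cnt n (GLarge 0) := by
  rw [cnt_succ]
  have h3 : cnt n (fun p => GLarge 0 (.L3 :: p)) = 0 :=
    cnt_false _ _ fun p H => absurd (((GLarge_cons _ _ _).1 H).2.1 rfl) (by omega)
  rw [h3]
  simp only [GLarge_cons, le_refl, reduceCtorEq, false_implies, true_and, MStep.height, add_zero,
    zero_add]
  change cnt n (GLarge 1) + cnt n (GLarge (-1)) + cnt n (GLarge (-1)) + cnt n (GLarge 0)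
    + cnt n (GLarge 0) = _
  rw [L_neg n (-1) (by omega)]
  ring

lemma L_eq (n : ℕ) : ∀ h : ℤ, cnt (n + 1) (GLarge h) =
    2 * cnt n (GM (h - 1)) + 2 * cnt n (GM h) := by
  classical
  induction n with
  | zero =>
    intro h
    rcases lt_trichotomy h 0 with hh | rfl | hh
    · rw [L_neg _ _ hh, M_neg _ _ hh, M_neg _ _ (by omega)]
    · rw [L_succ_zero]
      simp [cnt_zero, GM_nil, GLarge_nil]
    · rw [L_succ _ _ hh]
      simp only [cnt_zero, GM_nil, GLarge_nil]
      split_ifs <;> omega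
  | succ n ih =>
    intro h
    rcases lt_trichotomy h 0 with hh | rfl | hh
    · rw [L_neg _ _ hh, M_neg _ _ hh, M_neg _ _ (by omega)]
    · rw [L_succ_zero, ih, ih, M_succ _ _ le_rfl, M_neg (n + 1) (0 - 1) (by omega),
        M_neg n (0 - 1) (by omega)]
      simp only [sub_self, zero_add]
      ring
    · rw [L_succ _ _ hh, ih, ih, ih, M_succ _ _ hh.le, M_succ n (h - 1) (by omega)]
      simp only [add_sub_cancel_right, sub_add_cancel]
      ring

/-- For `n ≥ 1`, the number of large (3,2)-Motzkin paths of length `n` is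
twice the number of (3,2)-Motzkin paths of length `n - 1`. -/
theorem large_motzkin32_eq_two_mul_motzkin32 (n : ℕ) (hn : 1 ≤ n) :
    L32 n = 2 * m32 (n - 1) := by
  obtain ⟨k, rfl⟩ : ∃ k, n = k + 1 := ⟨n - 1, by omega⟩
  have hL : L32 (k + 1) = cnt (k + 1) (GLarge 0) := by
    simp only [L32, cnt, GLarge, GM, IsLargeMotzkin32, IsMotzkin32, zero_add]
  have hM : m32 k = cnt k (GM 0) := by
    simp only [m32, cnt, GM, IsMotzkin32, zero_add]
  rw [hL, L_eq, M_neg k (0 - 1) (by omega), Nat.add_sub_cancel, hM]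
  ring
end

section
/- For every integer n ≥ 1, the n-th large Schröder number equals twice the n-th little Schröder number: the number of large Schröder paths of length 2n is exactly twice the number of little Schröder paths of length 2n, i.e., S_n = 2·s_n. -/
/-- A Schröder path without any width constraint. -/
def SchPath (p : List SStep) : Prop :=
  (∀ q : List SStep, q <+: p → 0 ≤ sHeight q) ∧ sHeight p = 0

/-- No level step on the axis. -/
def NoAxisL (p : List SStep) : Prop :=
  ∀ a b : List SStep, p = a ++ SStep.L :: b → 0 < sHeight a

/-- Pairs of a large path and a little path of total width `2n - 2`. -/
def SchPairs (n : ℕ) : Set (List SStep × List SStep) :=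
  {x | SchPath x.1 ∧ SchPath x.2 ∧ NoAxisL x.2 ∧ sWidth x.1 + sWidth x.2 + 2 = 2 * n}

@[simp] theorem sHeight_nil : sHeight [] = 0 := rfl
@[simp] theorem sHeight_cons (x : SStep) (p : List SStep) :
    sHeight (x :: p) = x.height + sHeight p := by simp [sHeight]
@[simp] theorem sHeight_append (p q : List SStep) :
    sHeight (p ++ q) = sHeight p + sHeight q := by simp [sHeight]
@[simp] theorem sWidth_nil : sWidth [] = 0 := rfl
@[simp] theorem sWidth_cons (x : SStep) (p : List SStep) :
    sWidth (x :: p) = x.width + sWidth p := by simp [sWidth]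
@[simp] theorem sWidth_append (p q : List SStep) :
    sWidth (p ++ q) = sWidth p + sWidth q := by simp [sWidth]
@[simp] theorem sheight_U : SStep.height .U = 1 := rfl
@[simp] theorem sheight_L : SStep.height .L = 0 := rfl
@[simp] theorem sheight_D : SStep.height .D = -1 := rfl
@[simp] theorem swidth_U : SStep.width .U = 1 := rfl
@[simp] theorem swidth_L : SStep.width .L = 2 := rfl
@[simp] theorem swidth_D : SStep.width .D = 1 := rfl

/-- Prefixes of an append followed by a marked step. -/
theorem prefix_mid {q a b : List SStep} {x : SStep} (h : q <+: a ++ x :: b) :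
    q <+: a ∨ ∃ r, r <+: b ∧ q = a ++ x :: r := by
  obtain ⟨t, ht⟩ := h
  rcases List.append_eq_append_iff.1 ht with ⟨c, h1, h2⟩ | ⟨c, h1, h2⟩
  · exact Or.inl ⟨c, h1.symm⟩
  · cases c with
    | nil => left; simp [h1]
    | cons y c =>
      simp only [List.cons_append, List.cons.injEq] at h2
      right
      exact ⟨c, ⟨t, h2.2.symm⟩, by rw [h1, h2.1]⟩

theorem f_inj (n : ℕ) : Set.InjOn (fun x : List SStep × List SStep => x.1 ++ SStep.L :: x.2)
    (SchPairs n) := by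
  have key : ∀ a b c b' : List SStep, SchPath a → SchPath (a ++ c) → NoAxisL b →
      SStep.L :: b = c ++ SStep.L :: b' → c = [] := by
    intro a b c b' ha hac hb h
    cases c with
    | nil => rfl
    | cons y c =>
      simp only [List.cons_append, List.cons.injEq] at h
      have h1 := hb _ _ h.2
      have h2 := hac.2
      have h3 := ha.2
      rw [← h.1] at h2
      simp at h2
      omega
  rintro ⟨a, b⟩ ⟨ha, hb, hbL, -⟩ ⟨a', b'⟩ ⟨ha', hb', hbL', -⟩ h
  simp only at h ha hb hbL ha' hb' hbL'
  rcases List.append_eq_append_iff.1 h with ⟨c, h1, h2⟩ | ⟨c, h1, h2⟩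
  · have := key a b c b' ha (h1 ▸ ha') hbL h2
    subst this
    simp_all
  · have := key a' b' c b ha' (h1 ▸ ha) hbL' h2
    subst this
    simp_all

theorem g_inj (n : ℕ) :
    Set.InjOn (fun x : List SStep × List SStep => SStep.U :: (x.1 ++ SStep.D :: x.2))
    (SchPairs n) := by
  have key : ∀ a b c b' : List SStep, SchPath a → SchPath (a ++ c) →
      SStep.D :: b = c ++ SStep.D :: b' → c = [] := by
    intro a b c b' ha hac h
    cases c with
    | nil => rfl
    | cons y c =>
      simp only [List.cons_append, List.cons.injEq] at h
      have h1 := hac.1 (a ++ [y]) ⟨c, by simp⟩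
      have h3 := ha.2
      rw [← h.1] at h1
      simp at h1
      omega
  rintro ⟨a, b⟩ ⟨ha, hb, hbL, -⟩ ⟨a', b'⟩ ⟨ha', hb', hbL', -⟩ h
  simp only [List.cons.injEq, true_and] at h ha hb hbL ha' hb' hbL'
  rcases List.append_eq_append_iff.1 h with ⟨c, h1, h2⟩ | ⟨c, h1, h2⟩
  · have := key a b c b' ha (h1 ▸ ha') h2
    subst this
    simp_all
  · have := key a' b' c b ha' (h1 ▸ ha) h2
    subst this
    simp_all

/-- The last axis level step. -/
theorem exists_last_L (b : List SStep) (h : ¬ NoAxisL b) :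
    ∃ c d, b = c ++ SStep.L :: d ∧ sHeight c ≤ 0 ∧
      ∀ e f, d = e ++ SStep.L :: f → 0 < sHeight (c ++ SStep.L :: e) := by
  classical
  have hex : ∃ k, ∃ c d : List SStep, b = c ++ SStep.L :: d ∧ sHeight c ≤ 0 ∧ d.length = k := by
    unfold NoAxisL at h
    push Not at h
    obtain ⟨c, d, h1, h2⟩ := h
    exact ⟨_, c, d, h1, h2, rfl⟩
  obtain ⟨c, d, h1, h2, h3⟩ := Nat.find_spec hex
  refine ⟨c, d, h1, h2, ?_⟩
  intro e f hd
  by_contra hcon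
  have hlt : f.length < Nat.find hex := by rw [← h3, hd]; simp; omega
  exact Nat.find_min hex hlt ⟨c ++ SStep.L :: e, f, by simp [h1, hd], by omega, rfl⟩

/-- First passage below zero. -/
theorem exists_first_neg (p : List SStep) (h : sHeight p < 0) :
    ∃ a b, p = a ++ SStep.D :: b ∧ SchPath a := by
  induction hk : p.length using Nat.strong_induction_on generalizing p with
  | _ k ih =>
    subst hk
    rcases List.eq_nil_or_concat p with rfl | ⟨p, x, rfl⟩
    · simp at h
    by_cases hp : ∀ q, q <+: p → 0 ≤ sHeight q
    · have h1 := hp p (List.prefix_refl p)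
      cases x <;> simp at h
      · omega
      · omega
      · exact ⟨p, [], by simp, hp, by omega⟩
    · push Not at hp
      obtain ⟨q, ⟨t, rfl⟩, hq⟩ := hp
      obtain ⟨a, b, h1, h2⟩ := ih q.length (by simp) q hq rfl
      exact ⟨a, b ++ t ++ [x], by simp [h1], h2⟩

theorem f_image (n : ℕ) :
    (fun x : List SStep × List SStep => x.1 ++ SStep.L :: x.2) '' SchPairs n =
      {p | IsLargeSchroeder n p ∧ ¬ NoAxisL p} := by
  ext p
  constructor
  · rintro ⟨⟨a, b⟩, ⟨ha, hb, hbL, hw⟩, rfl⟩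
    simp only at ha hb hbL hw ⊢
    have := ha.2
    have := hb.2
    refine ⟨⟨by simp; omega, ?_, by simp; omega⟩, ?_⟩
    · intro q hq
      rcases prefix_mid hq with h | ⟨r, hr, rfl⟩
      · exact ha.1 q h
      · have := hb.1 r hr
        simp; omega
    · intro h
      have := h a b rfl
      omega
  · rintro ⟨⟨hw, hpre, h0⟩, hL⟩
    obtain ⟨c, d, rfl, hc, hl⟩ := exists_last_L p hL
    have hc0 := hpre c ⟨_, rfl⟩
    simp at hw h0
    refine ⟨(c, d), ⟨⟨?_, by simp; omega⟩, ⟨?_, by simp; omega⟩, ?_, by simp; omega⟩, rfl⟩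
    · intro q hq
      exact hpre q (hq.trans ⟨_, rfl⟩)
    · rintro q ⟨t, rfl⟩
      have := hpre (c ++ SStep.L :: q) ⟨t, by simp⟩
      simp at this; omega
    · intro e f h
      have := hl e f h
      simp at this; omega

theorem g_image (n : ℕ) (hn : 1 ≤ n) :
    (fun x : List SStep × List SStep => SStep.U :: (x.1 ++ SStep.D :: x.2)) '' SchPairs n =
      {p | IsLittleSchroeder n p} := by
  ext p
  constructor
  · rintro ⟨⟨a, b⟩, ⟨ha, hb, hbL, hw⟩, rfl⟩
    simp only at ha hb hbL hw ⊢
    have := ha.2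
    have := hb.2
    refine ⟨⟨by simp; omega, ?_, by simp; omega⟩, ?_⟩
    · intro q hq
      cases q with
      | nil => simp
      | cons y q =>
        obtain ⟨rfl, hq2⟩ := List.cons_prefix_cons.1 hq
        rcases prefix_mid hq2 with h | ⟨r, hr, rfl⟩
        · have := ha.1 q h
          simp; omega
        · have := hb.1 r hr
          simp; omega
    · intro e f h
      cases e with
      | nil => simp at h
      | cons y e =>
        simp only [List.cons_append, List.cons.injEq] at h
        obtain ⟨rfl, h⟩ := h
        rcases List.append_eq_append_iff.1 h with ⟨c, h1, h2⟩ | ⟨c, h1, h2⟩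
        · cases c with
          | nil => simp at h2
          | cons z c =>
            simp only [List.cons_append, List.cons.injEq] at h2
            obtain ⟨rfl, h2⟩ := h2
            have := hbL _ _ h2
            subst h1
            simp; omega
        · have := ha.1 e ⟨c, h1.symm⟩
          simp; omega
  · rintro ⟨⟨hw, hpre, h0⟩, hL⟩
    rcases p with _ | ⟨x, p⟩
    · simp at hw; omega
    cases x with
    | L => have := hL [] p rfl; simp at this
    | D => have := hpre [SStep.D] ⟨p, rfl⟩; simp at this
    | U =>
      simp at h0
      obtain ⟨a, b, rfl, ha⟩ := exists_first_neg p (by omega)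
      have ha2 := ha.2
      simp at hw h0
      refine ⟨(a, b), ⟨ha, ⟨?_, by simp; omega⟩, ?_, by simp; omega⟩, rfl⟩
      · rintro q ⟨t, rfl⟩
        have := hpre (SStep.U :: (a ++ SStep.D :: q)) ⟨t, by simp⟩
        simp at this; omega
      · rintro e f h
        have := hL (SStep.U :: (a ++ SStep.D :: e)) f (by simp at h; simp [h])
        simp at this; omega

/-- For `n ≥ 1`, the `n`-th large Schröder number is twice the `n`-th little
Schröder number. -/
theorem schroeder_large_eq_two_mul_little (n : ℕ) (hn : 1 ≤ n) :
    SchroederLarge n = 2 * SchroederLittle n := by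
  have hf := Set.ncard_image_of_injOn (f_inj n)
  have hg := Set.ncard_image_of_injOn (g_inj n)
  have hfi := f_image n
  have hgi := g_image n hn
  have hU : {p | IsLargeSchroeder n p} =
      {p | IsLittleSchroeder n p} ∪ {p | IsLargeSchroeder n p ∧ ¬ NoAxisL p} := by
    ext p
    simp only [Set.mem_setOf_eq, Set.mem_union, IsLittleSchroeder]
    change _ ↔ (_ ∧ NoAxisL p) ∨ _
    tauto
  unfold SchroederLarge SchroederLittle
  rw [hU, ← hfi, ← hgi]
  by_cases hfin : (SchPairs n).Finite
  · rw [Set.ncard_union_eq ?_ (hfin.image _) (hfin.image _), hf, hg]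
    · omega
    · rw [hfi, hgi, Set.disjoint_left]
      intro p hp hq
      exact hq.2 hp.2
  · have hi : ((fun x : List SStep × List SStep => SStep.U :: (x.1 ++ SStep.D :: x.2)) ''
        SchPairs n).Infinite := Set.Infinite.image (g_inj n) hfin
    rw [hi.ncard, (hi.mono Set.subset_union_left).ncard]
end
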